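/- Let R=(R_1,…,R_m) and S=(S_1,…,S_n) be partitions of the same weight with m>2 and n>2 such that A(R,S) is nonempty, and let t be a positive integer. Let f be the minimum integer with φ_{2,f} = t_{2,f} and f′ be the minimum integer with φ_{1,f′} = t_{1,f′}. If 1 ≤ f < f′ < n, if S_f = S_{f+1} = … = S_n = 1, and if for every k with 1 ≤ k ≤ t one has ρ̃_k(R,S) ∈ {k + f′, 2k + f}, then there exists a matrix A ∈ A(R,S) such that ρ_k(A) = ρ̃_k(R,S) for all k = 1,…,t. -/

import Mathlib

open Finset

/-- `A` is a `(0,1)`-matrix: every entry is `0` or `1`. -/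
def IsZeroOne {m n : ℕ} (A : Matrix (Fin m) (Fin n) ℕ) : Prop :=
  ∀ i j, A i j = 0 ∨ A i j = 1

/-- The class `𝒜(R,S)` of `(0,1)`-matrices with row sum vector `R` and
column sum vector `S`. -/
def ARS {m n : ℕ} (R : Fin m → ℕ) (S : Fin n → ℕ) :
    Set (Matrix (Fin m) (Fin n) ℕ) :=
  {A | IsZeroOne A ∧ (∀ i, ∑ j, A i j = R i) ∧ (∀ j, ∑ i, A i j = S j)}

/-- `R` and `S` are partitions of the same weight. -/
def IsPartitionPair {m n : ℕ} (R : Fin m → ℕ) (S : Fin n → ℕ) : Prop :=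
  Antitone R ∧ (∀ i, 0 < R i) ∧ Antitone S ∧ (∀ j, 0 < S j) ∧
    ∑ i, R i = ∑ j, S j

/-- The rows `E` and the columns `F` cover all the `1`'s of `A`. -/
def Covers {m n : ℕ} (A : Matrix (Fin m) (Fin n) ℕ)
    (E : Finset (Fin m)) (F : Finset (Fin n)) : Prop :=
  ∀ i j, A i j = 1 → i ∈ E ∨ j ∈ F

/-- The `t`-term rank of `A`: the maximum number of `1`'s of `A` with at most
one `1` in each column and at most `t` `1`'s in each row. -/
def tTermRank {m n : ℕ} (t : ℕ) (A : Matrix (Fin m) (Fin n) ℕ) : ℕ :=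
  Finset.sup ((Finset.univ : Finset (Fin m × Fin n)).powerset.filter fun P =>
      (∀ p ∈ P, A p.1 p.2 = 1) ∧
      (∀ j : Fin n, (P.filter fun p => p.2 = j).card ≤ 1) ∧
      (∀ i : Fin m, (P.filter fun p => p.1 = i).card ≤ t))
    Finset.card

/-- The minimum `t`-term rank over the class `𝒜(R,S)`. -/
noncomputable def minTermRank {m n : ℕ} (t : ℕ) (R : Fin m → ℕ)
    (S : Fin n → ℕ) : ℕ :=
  sInf {r : ℕ | ∃ A ∈ ARS R S, tTermRank t A = r}

/-- The structure matrix `t_{k,l}` associated with `R` and `S`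
(`R`, `S` being 1-indexed in the paper, here 0-indexed):
`t_{k,l} = k·l − ∑_{j=1}^{l} S_j + ∑_{i=k+1}^{m} R_i`. -/
def structMat {m n : ℕ} (R : Fin m → ℕ) (S : Fin n → ℕ) (k l : ℕ) : ℤ :=
  (k : ℤ) * l - ∑ j ∈ Finset.univ.filter (fun j : Fin n => (j : ℕ) < l), (S j : ℤ)
    + ∑ i ∈ Finset.univ.filter (fun i : Fin m => k ≤ (i : ℕ)), (R i : ℤ)

/-- `φ_{k,l} = min { t_{i1,l+j2} + t_{k+i2,j1} + (k−i1)(l−j1) }` over all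
`0 ≤ i1 ≤ k ≤ k+i2 ≤ m` and `0 ≤ j1 ≤ l ≤ l+j2 ≤ n`. -/
noncomputable def phi {m n : ℕ} (R : Fin m → ℕ) (S : Fin n → ℕ) (k l : ℕ) : ℤ :=
  sInf {v : ℤ | ∃ i1 i2 j1 j2 : ℕ,
    i1 ≤ k ∧ k + i2 ≤ m ∧ j1 ≤ l ∧ l + j2 ≤ n ∧
    v = structMat R S i1 (l + j2) + structMat R S (k + i2) j1
        + ((k : ℤ) - i1) * ((l : ℤ) - j1)}

/-- `ψ_{a,b;c,d}` as in the paper, the minimum being taken over all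
`0 ≤ i1 ≤ a ≤ a+i2 ≤ b ≤ b+i3 ≤ m` and `0 ≤ j1 ≤ c ≤ c+j2 ≤ d ≤ d+j3 ≤ n`. -/
noncomputable def psi {m n : ℕ} (R : Fin m → ℕ) (S : Fin n → ℕ)
    (a b c d : ℕ) : ℤ :=
  sInf {v : ℤ | ∃ i1 i2 i3 j1 j2 j3 : ℕ,
    i1 ≤ a ∧ a + i2 ≤ b ∧ b + i3 ≤ m ∧
    j1 ≤ c ∧ c + j2 ≤ d ∧ d + j3 ≤ n ∧
    v = structMat R S i1 (d + j3) + structMat R S (a + i2) (c + j2)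
        + structMat R S (b + i3) j1
        + ((a : ℤ) - i1) * ((d : ℤ) - (c : ℤ) - j2)
        + ((b : ℤ) - (a : ℤ) - i2) * ((c : ℤ) - j1)
        + ((a : ℤ) - i1) * ((c : ℤ) - j1)}

/-- **Gale–Ryser theorem**, in the form given by Hall's marriage theorem. -/
theorem exists_zeroOne_of_forall_card_mul_card_le {ι κ : Type*} [Fintype ι] [Fintype κ]
    [DecidableEq ι] [DecidableEq κ] (r : ι → ℤ) (s : κ → ℕ)
    (htot : ∑ i, r i = ∑ j, (s j : ℤ))
    (h : ∀ (I : Finset ι) (J : Finset κ),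
      (#I : ℤ) * #J ≤ ∑ j ∈ J, (s j : ℤ) + ∑ i ∈ I, ((Fintype.card κ : ℤ) - r i)) :
    ∃ B : ι → κ → ℕ, (∀ i j, B i j = 0 ∨ B i j = 1) ∧
      (∀ i, ∑ j, (B i j : ℤ) = r i) ∧ ∀ j, ∑ i, B i j = s j := by
  have hr : ∀ i, 0 ≤ (Fintype.card κ : ℤ) - r i := fun i => by
    simpa using h {i} ∅
  set c : ι → ℕ := fun i => ((Fintype.card κ : ℤ) - r i).toNat
  have hcr : ∀ i, (c i : ℤ) = (Fintype.card κ : ℤ) - r i := fun i => Int.toNat_of_nonneg (hr i)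
  let slots : Finset ι → Finset κ → Finset ((Σ j : κ, Fin (s j)) ⊕ (Σ i : ι, Fin (c i))) :=
    fun I J => (J.sigma fun _ => univ).disjSum (I.sigma fun _ => univ)
  have hslots : ∀ I J, #(slots I J) = ∑ j ∈ J, s j + ∑ i ∈ I, c i := fun I J => by
    simp [slots, card_disjSum, card_sigma]
  obtain ⟨g, hginj, hg⟩ := (all_card_le_biUnion_card_iff_exists_injective
    (fun x : ι × κ => slots {x.1} {x.2})).1 (fun X => by
      have hsub : slots (X.image Prod.fst) (X.image Prod.snd) ⊆
          X.biUnion fun x => slots {x.1} {x.2} := by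
        rintro (⟨j, u⟩ | ⟨i, u⟩) hx
        · simp only [slots, inl_mem_disjSum, mem_sigma, mem_image, mem_univ, and_true] at hx
          obtain ⟨x, hx, hj⟩ := hx
          exact mem_biUnion.2 ⟨x, hx, by simp [slots, hj]⟩
        · simp only [slots, inr_mem_disjSum, mem_sigma, mem_image, mem_univ, and_true] at hx
          obtain ⟨x, hx, hj⟩ := hx
          exact mem_biUnion.2 ⟨x, hx, by simp [slots, hj]⟩
      refine le_trans ?_ (card_le_card hsub)
      rw [hslots]
      have h1 : #X ≤ #(X.image Prod.fst) * #(X.image Prod.snd) := by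
        rw [← card_product]
        exact card_le_card fun x hx =>
          mem_product.2 ⟨mem_image_of_mem _ hx, mem_image_of_mem _ hx⟩
      have h2 := h (X.image Prod.fst) (X.image Prod.snd)
      simp only [← hcr] at h2
      exact h1.trans (by exact_mod_cast h2))
  have hcol : ∀ j, ∑ i, (if (g (i, j)).isLeft then 1 else 0) ≤ s j := fun j => by
    rw [← card_filter]
    have hle := card_le_card_of_injOn (s := univ.filter fun i => (g (i, j)).isLeft)
      (t := slots ∅ {j}) (fun i => g (i, j)) (fun i hi => by
        have h1 := hg (i, j)
        have h2 : (g (i, j)).isLeft := by simpa using hi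
        dsimp only
        revert h1 h2
        generalize g (i, j) = y
        rcases y with y | y <;> simp [slots])
      (fun i _ i' _ hii => (Prod.mk.inj (hginj hii)).1)
    simpa [hslots] using hle
  have hrow : ∀ i, r i ≤ ∑ j, (((if (g (i, j)).isLeft then 1 else 0 : ℕ)) : ℤ) := fun i => by
    have hle := card_le_card_of_injOn (s := univ.filter fun j => ¬ (g (i, j)).isLeft)
      (t := slots {i} ∅) (fun j => g (i, j)) (fun j hj => by
        have h1 := hg (i, j)
        have h2 : ¬ (g (i, j)).isLeft := by simpa using hj
        dsimp only
        revert h1 h2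
        generalize g (i, j) = y
        rcases y with y | y <;> simp [slots])
      (fun j _ j' _ hjj => (Prod.mk.inj (hginj hjj)).2)
    have hsplit := card_filter_add_card_filter_not (s := (univ : Finset κ))
      (fun j => ((g (i, j)).isLeft : Prop))
    rw [← Nat.cast_sum, ← card_filter]
    have h3 := hcr i
    simp only [hslots, sum_singleton, sum_empty, zero_add] at hle
    rw [card_univ] at hsplit
    omega
  have hswap : ∑ i, ∑ j, (((if (g (i, j)).isLeft then 1 else 0 : ℕ)) : ℤ)
      = ∑ j, ((∑ i, (if (g (i, j)).isLeft then 1 else 0) : ℕ) : ℤ) := by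
    rw [sum_comm]; push_cast; rfl
  have hle1 := sum_le_sum fun i (_ : i ∈ univ) => hrow i
  have hle2 : ∑ j, ((∑ i, (if (g (i, j)).isLeft then 1 else 0) : ℕ) : ℤ) ≤ ∑ j, (s j : ℤ) :=
    sum_le_sum fun j _ => by exact_mod_cast hcol j
  refine ⟨fun i j => if (g (i, j)).isLeft then 1 else 0, fun i j => ?_, fun i => ?_, fun j => ?_⟩
  · dsimp only
    split_ifs <;> simp
  · exact (((sum_eq_sum_iff_of_le fun i _ => hrow i).1 (by linarith)) i (mem_univ i)).symm
  · have := ((sum_eq_sum_iff_of_le (s := univ) (f := fun j =>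
      ((∑ i, (if (g (i, j)).isLeft then 1 else 0) : ℕ) : ℤ)) (g := fun j => (s j : ℤ))
      fun j _ => by exact_mod_cast hcol j).1 (by linarith)) j (mem_univ j)
    exact_mod_cast this

theorem sum_le_sum_Ico_of_antitone {g : ℕ → ℤ} (hg : Antitone g) (k : ℕ) (I : Finset ℕ)
    (hI : ∀ i ∈ I, k ≤ i) : ∑ i ∈ I, g i ≤ ∑ i ∈ Ico k (k + #I), g i := by
  induction I using Finset.induction_on_max with
  | empty => simp
  | insert a s hmax ih =>
    have ha : a ∉ s := fun h => lt_irrefl _ (hmax a h)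
    have hsub : s ⊆ Ico k a := fun x hx =>
      mem_Ico.2 ⟨hI x (mem_insert_of_mem hx), hmax x hx⟩
    have hcard := card_le_card hsub
    rw [Nat.card_Ico] at hcard
    have hka := hI a (mem_insert_self a s)
    rw [sum_insert ha, card_insert_of_notMem ha, ← add_assoc,
      sum_Ico_succ_top (Nat.le_add_right _ _)]
    have h1 := ih fun i hi => hI i (mem_insert_of_mem hi)
    have h2 : g a ≤ g (k + #s) := hg (by omega)
    linarith

theorem sum_le_sum_range_sub_of_antitone {g : ℕ → ℤ} (hg : Antitone g) (k : ℕ) (I : Finset ℕ)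
    (hI : ∀ i ∈ I, k ≤ i) :
    ∑ i ∈ I, g i ≤ ∑ i ∈ range (k + #I), g i - ∑ i ∈ range k, g i := by
  rw [← sum_Ico_eq_sub _ (Nat.le_add_right _ _)]
  exact sum_le_sum_Ico_of_antitone hg k I hI

theorem sum_range_sub_le_sum_of_antitone {g : ℕ → ℤ} (hg : Antitone g) (l : ℕ) (J : Finset ℕ)
    (hJ : J ⊆ range l) :
    ∑ i ∈ range l, g i - ∑ i ∈ range (l - #J), g i ≤ ∑ i ∈ J, g i := by
  have h1 := sum_le_sum_range_sub_of_antitone hg 0 (range l \ J) (by simp)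
  rw [card_sdiff_of_subset hJ, card_range, sum_range_zero, zero_add] at h1
  have h2 := sum_sdiff (f := g) hJ
  linarith

/-- Extension of a finite sequence of naturals by zeros. -/
def zeroExt {m : ℕ} (R : Fin m → ℕ) (i : ℕ) : ℕ :=
  if h : i < m then R ⟨i, h⟩ else 0

theorem zeroExt_val {m : ℕ} (R : Fin m → ℕ) (i : Fin m) : zeroExt R i = R i := by
  simp [zeroExt]

theorem antitone_zeroExt {m : ℕ} {R : Fin m → ℕ} (hR : Antitone R) :
    Antitone fun i => (zeroExt R i : ℤ) := by
  intro i j hij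
  simp only [zeroExt]
  split_ifs with h1 h2
  · exact_mod_cast hR (show (⟨i, h2⟩ : Fin m) ≤ ⟨j, h1⟩ from hij)
  · omega
  · positivity
  · rfl

theorem sum_eq_sum_range_zeroExt {m : ℕ} (R : Fin m → ℕ) :
    ∑ i, (R i : ℤ) = ∑ i ∈ range m, (zeroExt R i : ℤ) := by
  rw [← Fin.sum_univ_eq_sum_range (fun i => (zeroExt R i : ℤ))]
  simp [zeroExt_val]

theorem sum_filter_lt_eq_sum_range_zeroExt {m l : ℕ} (R : Fin m → ℕ) (hl : l ≤ m) :
    ∑ i ∈ univ.filter (fun i : Fin m => (i : ℕ) < l), (R i : ℤ) =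
      ∑ i ∈ range l, (zeroExt R i : ℤ) := by
  rw [sum_filter]
  have h := Fin.sum_univ_eq_sum_range (fun i => if i < l then (zeroExt R i : ℤ) else 0) m
  simp only [zeroExt_val] at h
  rw [h, ← sum_filter]
  congr 1
  ext i
  simp only [mem_filter, mem_range]
  omega

theorem structMat_eq {m n : ℕ} (R : Fin m → ℕ) (S : Fin n → ℕ) {k l : ℕ}
    (hk : k ≤ m) (hl : l ≤ n) :
    structMat R S k l = (k : ℤ) * l - ∑ j ∈ range l, (zeroExt S j : ℤ)
      + (∑ i ∈ range m, (zeroExt R i : ℤ) - ∑ i ∈ range k, (zeroExt R i : ℤ)) := by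
  have h := sum_filter_add_sum_filter_not univ (fun i : Fin m => (i : ℕ) < k)
    (fun i => (R i : ℤ))
  rw [sum_filter_lt_eq_sum_range_zeroExt R hk, sum_eq_sum_range_zeroExt] at h
  simp only [not_lt] at h
  rw [structMat, sum_filter_lt_eq_sum_range_zeroExt S hl]
  linarith

theorem phi_eq_structMat_iff {m n : ℕ} {R : Fin m → ℕ} {S : Fin n → ℕ}
    (htot : ∑ i, R i = ∑ j, S j) {k l : ℕ} (hk : k ≤ m) (hl : l ≤ n) :
    phi R S k l = structMat R S k l ↔
      ∀ i1 i2 j1 j2 : ℕ, i1 ≤ k → k + i2 ≤ m → j1 ≤ l → l + j2 ≤ n →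
        structMat R S k l ≤ structMat R S i1 (l + j2) + structMat R S (k + i2) j1
          + ((k : ℤ) - i1) * ((l : ℤ) - j1) := by
  constructor
  · intro h i1 i2 j1 j2 h1 h2 h3 h4
    rw [← h]
    refine csInf_le (Set.Finite.bddBelow ?_) ⟨i1, i2, j1, j2, h1, h2, h3, h4, rfl⟩
    refine ((range (k + 1) ×ˢ range (m + 1) ×ˢ range (l + 1) ×ˢ range (n + 1)).image
      fun x => structMat R S x.1 (l + x.2.2.2) + structMat R S (k + x.2.1) x.2.2.1
        + ((k : ℤ) - x.1) * ((l : ℤ) - x.2.2.1)).finite_toSet.subset ?_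
    rintro v ⟨i1, i2, j1, j2, h1, h2, h3, h4, rfl⟩
    refine mem_coe.2 (mem_image.2 ⟨(i1, i2, j1, j2), ?_, rfl⟩)
    simp only [mem_product, mem_range]
    omega
  · intro h
    refine IsLeast.csInf_eq ⟨⟨0, 0, l, n - l, by omega, by omega, le_rfl, by omega, ?_⟩, ?_⟩
    · have htot' : ∑ i, (R i : ℤ) = ∑ j, (S j : ℤ) := by exact_mod_cast htot
      rw [sum_eq_sum_range_zeroExt, sum_eq_sum_range_zeroExt] at htot'
      have h0 : structMat R S 0 n = 0 := by
        rw [structMat_eq R S (Nat.zero_le _) le_rfl, htot']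
        simp
      rw [Nat.add_sub_cancel' hl, h0]
      simp
    · rintro v ⟨i1, i2, j1, j2, h1, h2, h3, h4, rfl⟩
      exact h i1 i2 j1 j2 h1 h2 h3 h4

theorem tTermRank_le_of_covers {m n : ℕ} {A : Matrix (Fin m) (Fin n) ℕ}
    {E : Finset (Fin m)} {F : Finset (Fin n)} (h : Covers A E F) (k : ℕ) :
    tTermRank k A ≤ k * #E + #F := by
  refine Finset.sup_le fun P hP => ?_
  simp only [mem_filter] at hP
  obtain ⟨-, h1, hcol, hrow⟩ := hP
  have hsub : P ⊆ (E.biUnion fun i => P.filter fun p => p.1 = i) ∪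
      (F.biUnion fun j => P.filter fun p => p.2 = j) := by
    intro p hp
    rcases h p.1 p.2 (h1 p hp) with hE | hF
    · exact mem_union_left _ (mem_biUnion.2 ⟨p.1, hE, by simp [hp]⟩)
    · exact mem_union_right _ (mem_biUnion.2 ⟨p.2, hF, by simp [hp]⟩)
  refine (card_le_card hsub).trans ((card_union_le _ _).trans (add_le_add ?_ ?_))
  · rw [mul_comm]
    exact card_biUnion_le_card_mul _ _ _ fun i _ => hrow i
  · simpa using card_biUnion_le_card_mul F _ 1 fun j _ => hcol j

/-- Uncrossing of the extremal inequalities on prefix sums `P` of `R` and `Q` of `S`: a tight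
inequality for a set of rows avoiding the first one bounds the sums over the sets of rows that
contain the first row but not the second. -/
theorem prefix_sum_le_of_tight {P Q : ℕ → ℤ} {m f f' n : ℕ}
    (hboth : ∀ a j, 2 ≤ a → a ≤ m → j ≤ f → P a ≤ a * j + (Q f - Q j) + (n - f))
    (hneither : ∀ b j, 2 + b ≤ m → j ≤ f → P (2 + b) - P 2 ≤ b * j + (Q f - Q j))
    {q j₁ : ℕ} (hq1 : 1 ≤ q) (hqm : 1 + q ≤ m) (hj₁ : j₁ ≤ f)
    (htight : q * j₁ + (Q f - Q j₁) + (f' - f) ≤ P (1 + q) - P 1)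
    {p j : ℕ} (hp1 : 1 ≤ p) (hpm : 1 + p ≤ m) (hj : j ≤ f) :
    P 1 + (P (1 + p) - P 2) ≤ p * j + (Q f - Q j) + (n - f') := by
  have key : ∀ x y u v : ℕ, 1 ≤ y → y ≤ x → 1 + x ≤ m → u ≤ f → v ≤ f → u ≤ v →
      P (1 + x) + (P (1 + y) - P 2) ≤
        (x + 1) * u + (y - 1) * v + (Q f - Q u) + (Q f - Q v) + (n - f) := by
    intro x y u v hy hyx hx hu hv huv
    have h1 := hboth (1 + x) u (by omega) hx hu
    obtain ⟨b, rfl⟩ := Nat.exists_eq_add_of_le hy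
    have h2 := hneither b v (by omega) hv
    rw [show 1 + (1 + b) = 2 + b by ring]
    push_cast at h1 ⊢
    linarith
  rcases le_total p q with h1 | h1 <;> rcases le_total j j₁ with h2 | h2
  · have := key q p j j₁ hp1 h1 hqm hj hj₁ h2
    zify at h1 h2
    nlinarith [mul_nonneg (sub_nonneg.2 h1) (sub_nonneg.2 h2)]
  · have := key q p j₁ j hp1 h1 hqm hj₁ hj h2
    zify at h1 h2
    nlinarith
  · have := key p q j j₁ hq1 h1 hpm hj hj₁ h2
    zify at h1 h2
    nlinarith
  · have := key p q j₁ j hq1 h1 hpm hj₁ hj h2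
    zify at h1 h2
    nlinarith [mul_nonneg (sub_nonneg.2 h1) (sub_nonneg.2 h2)]

theorem sum_sub_indicator_le {g : ℕ → ℤ} (hg : Antitone g) {m : ℕ} (hm : 2 ≤ m) {x y c e : ℤ}
    {I : Finset ℕ} (hI : I ⊆ range m)
    (hboth : ∀ a : ℕ, 2 ≤ a → a ≤ m → ∑ i ∈ range a, g i ≤ a * c + e + (x + y))
    (hneither : ∀ b : ℕ, 2 + b ≤ m →
      ∑ i ∈ range (2 + b), g i - ∑ i ∈ range 2, g i ≤ b * c + e)
    (hfirst : ∀ p : ℕ, 1 ≤ p → 1 + p ≤ m →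
      ∑ i ∈ range 1, g i + (∑ i ∈ range (1 + p), g i - ∑ i ∈ range 2, g i) ≤ p * c + e + x)
    (hsecond : ∀ p : ℕ, 1 ≤ p → 1 + p ≤ m →
      ∑ i ∈ range (1 + p), g i - ∑ i ∈ range 1, g i ≤ p * c + e + y) :
    ∑ i ∈ I, (g i - ((if i = 0 then x else 0) + if i = 1 then y else 0)) ≤ #I * c + e := by
  have hcard := card_le_card hI
  rw [card_range] at hcard
  rw [sum_sub_distrib, sum_add_distrib, sum_ite_eq', sum_ite_eq']
  by_cases h0 : 0 ∈ I <;> by_cases h1 : 1 ∈ I <;> simp only [h0, h1, if_true, if_false]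
  · have h2 : 2 ≤ #I := by
      simpa using card_le_card (show ({0, 1} : Finset ℕ) ⊆ I by
        simp [insert_subset_iff, h0, h1])
    have h3 := sum_le_sum_range_sub_of_antitone hg 0 I (by simp)
    have h4 := hboth _ h2 hcard
    simp only [range_zero, sum_empty, zero_add] at h3
    linarith
  · have hlt : 1 + #I ≤ m := by
      have := card_le_card (insert_subset (mem_range.2 (show 1 < m by omega)) hI)
      rw [card_insert_of_notMem h1, card_range] at this
      omega
    have hpos : 1 ≤ #I := card_pos.2 ⟨0, h0⟩
    have h3 := sum_le_sum_range_sub_of_antitone hg 2 (I.erase 0) (fun i hi => by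
      obtain ⟨hi0, hi⟩ := mem_erase.1 hi
      have : i ≠ 1 := fun h => h1 (h ▸ hi)
      omega)
    have h4 := hfirst _ hpos hlt
    rw [card_erase_of_mem h0, show 2 + (#I - 1) = 1 + #I by omega] at h3
    have h5 := add_sum_erase I g h0
    rw [sum_range_one] at h4
    linarith
  · have hlt : 1 + #I ≤ m := by
      have := card_le_card (insert_subset (mem_range.2 (show 0 < m by omega)) hI)
      rw [card_insert_of_notMem h0, card_range] at this
      omega
    have hpos : 1 ≤ #I := card_pos.2 ⟨1, h1⟩
    have h3 := sum_le_sum_range_sub_of_antitone hg 1 I (fun i hi => by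
      have : i ≠ 0 := fun h => h0 (h ▸ hi)
      omega)
    have h4 := hsecond _ hpos hlt
    linarith
  · have hlt : 2 + #I ≤ m := by
      have := card_le_card (insert_subset (mem_range.2 (show 0 < m by omega))
        (insert_subset (mem_range.2 (show 1 < m by omega)) hI))
      rw [card_insert_of_notMem (by simp [h0]), card_insert_of_notMem h1, card_range] at this
      omega
    have h3 := sum_le_sum_range_sub_of_antitone hg 2 I (fun i hi => by
      have : i ≠ 0 := fun h => h0 (h ▸ hi)
      have : i ≠ 1 := fun h => h1 (h ▸ hi)
      omega)
    have h4 := hneither _ hlt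
    linarith

theorem sum_range_zeroExt_eq_add_sub {n : ℕ} {S : Fin n → ℕ} {f l : ℕ}
    (hS : ∀ j : Fin n, f ≤ (j : ℕ) → S j = 1) (hfl : f ≤ l) (hl : l ≤ n) :
    ∑ j ∈ range l, (zeroExt S j : ℤ) = ∑ j ∈ range f, (zeroExt S j : ℤ) + ((l : ℤ) - f) := by
  have h : ∑ j ∈ Ico f l, (zeroExt S j : ℤ) = ∑ j ∈ Ico f l, (1 : ℤ) :=
    sum_congr rfl fun j hj => by
      rw [mem_Ico] at hj
      have hjn : j < n := by omega
      simp [zeroExt, hjn, hS ⟨j, hjn⟩ hj.1]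
  rw [sum_Ico_eq_sub _ hfl] at h
  simp only [sum_const, Nat.card_Ico, nsmul_eq_mul, mul_one, Nat.cast_sub hfl] at h
  linarith

/-- A matrix of `𝒜(R,S)` whose `1`'s are covered both by the first row with the first `f'`
columns and by the first two rows with the first `f` columns. -/
theorem exists_mem_ARS_covers_covers {m n : ℕ} {R : Fin m → ℕ} {S : Fin n → ℕ} (hm : 2 ≤ m)
    (hR : Antitone R) (hS : Antitone S) (htot : ∑ i, R i = ∑ j, S j) {f f' : ℕ}
    (hff' : f ≤ f') (hf'n : f' ≤ n) (hS1 : ∀ j : Fin n, f ≤ (j : ℕ) → S j = 1) {P Q : ℕ → ℤ}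
    (hP : ∀ k, P k = ∑ i ∈ range k, (zeroExt R i : ℤ))
    (hQ : ∀ l, Q l = ∑ j ∈ range l, (zeroExt S j : ℤ))
    (hboth : ∀ a j : ℕ, 2 ≤ a → a ≤ m → j ≤ f → P a ≤ a * j + (Q f - Q j) + (n - f))
    (hneither : ∀ b j : ℕ, 2 + b ≤ m → j ≤ f → P (2 + b) - P 2 ≤ b * j + (Q f - Q j))
    (hfirst : ∀ p j : ℕ, 1 ≤ p → 1 + p ≤ m → j ≤ f →
      P 1 + (P (1 + p) - P 2) ≤ p * j + (Q f - Q j) + (n - f'))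
    (hsecond : ∀ p j : ℕ, 1 ≤ p → 1 + p ≤ m → j ≤ f →
      P (1 + p) - P 1 ≤ p * j + (Q f - Q j) + (f' - f)) :
    ∃ A ∈ ARS R S, Covers A {i | (i : ℕ) < 1} {j | (j : ℕ) < f'} ∧
      Covers A {i | (i : ℕ) < 2} {j | (j : ℕ) < f} := by
  set w : ℕ → ℤ := fun i =>
    (if i = 0 then (n : ℤ) - f' else 0) + if i = 1 then (f' : ℤ) - f else 0 with hw
  have hQn : Q n = Q f + (n - f) := by
    rw [hQ, hQ, sum_range_zeroExt_eq_add_sub hS1 (hff'.trans hf'n) le_rfl]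
  have htot' : P m = Q n := by
    rw [hP, hQ, ← sum_eq_sum_range_zeroExt, ← sum_eq_sum_range_zeroExt]
    exact_mod_cast htot
  have hbound : ∀ (I : Finset (Fin m)) (j : ℕ), j ≤ f →
      ∑ i ∈ I, ((R i : ℤ) - w i) ≤ #I * j + (Q f - Q j) := by
    intro I j hj
    have h := sum_sub_indicator_le (antitone_zeroExt hR) hm (x := n - f') (y := f' - f)
      (c := j) (e := Q f - Q j) (I := I.map Fin.valEmbedding)
      (fun i hi => by
        obtain ⟨i, -, rfl⟩ := mem_map.1 hi
        exact mem_range.2 i.2)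
      (fun a h1 h2 => by
        rw [← hP]
        linarith [hboth a j h1 h2 hj])
      (fun b h1 => by
        rw [← hP, ← hP]
        exact hneither b j h1 hj)
      (fun p h1 h2 => by
        rw [← hP, ← hP, ← hP]
        exact hfirst p j h1 h2 hj)
      (fun p h1 h2 => by
        rw [← hP, ← hP]
        exact hsecond p j h1 h2 hj)
    simpa [zeroExt_val, hw] using h
  obtain ⟨B, hB, hBrow, hBcol⟩ := exists_zeroOne_of_forall_card_mul_card_le
    (fun i : Fin m => (R i : ℤ) - w i) (fun j : Fin f => zeroExt S j)
    (by
      rw [sum_sub_distrib, sum_eq_sum_range_zeroExt, ← hP, htot', hQn,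
        Fin.sum_univ_eq_sum_range (fun j => (zeroExt S j : ℤ)), ← hQ,
        Fin.sum_univ_eq_sum_range w, hw, sum_add_distrib, sum_ite_eq', sum_ite_eq',
        if_pos (by simp; omega), if_pos (by simp; omega)]
      ring)
    (fun I J => by
      have h1 := hbound I (f - #J) (Nat.sub_le _ _)
      have hJ : #J ≤ f := by simpa using card_le_univ J
      have h2 := sum_range_sub_le_sum_of_antitone (antitone_zeroExt hS) f
        (J.map Fin.valEmbedding) (fun j hj => by
          obtain ⟨j, -, rfl⟩ := mem_map.1 hj
          exact mem_range.2 j.2)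
      rw [card_map, sum_map, ← hQ, ← hQ] at h2
      simp only [Fin.valEmbedding_apply] at h2
      rw [sum_sub_distrib (f := fun _ => (Fintype.card (Fin f) : ℤ)), sum_const,
        Fintype.card_fin, nsmul_eq_mul]
      rw [Nat.cast_sub hJ] at h1
      linarith)
  obtain ⟨d, rfl⟩ := Nat.exists_eq_add_of_le hff'
  obtain ⟨e, rfl⟩ := Nat.exists_eq_add_of_le hf'n
  refine ⟨fun i j => if h : (j : ℕ) < f then B i ⟨j, h⟩ else
    if (j : ℕ) < f + d then (if (i : ℕ) = 1 then 1 else 0) else if (i : ℕ) = 0 then 1 else 0,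
    ⟨fun i j => ?_, fun i => ?_, fun j => ?_⟩, fun i j => ?_, fun i j => ?_⟩
  · dsimp only
    split_ifs <;> simp [hB]
  · have h := hBrow i
    rw [Fin.sum_univ_add, Fin.sum_univ_add]
    have hsum : ∑ j, B i j + (∑ _j : Fin d, if (i : ℕ) = 1 then 1 else 0) +
        (∑ _j : Fin e, if (i : ℕ) = 0 then 1 else 0) = R i := by
      rw [← Nat.cast_sum] at h
      simp only [sum_const, card_univ, Fintype.card_fin, smul_eq_mul, hw] at h ⊢
      split_ifs at h ⊢ <;> omega
    rw [← hsum]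
    simp [add_assoc]
  · dsimp only
    split_ifs with h1 h2
    · rw [hBcol]
      exact zeroExt_val S j
    · rw [hS1 j (by omega)]
      rw [Fin.sum_univ_eq_sum_range (fun i => if i = 1 then 1 else 0), sum_ite_eq',
        if_pos (mem_range.2 (by omega))]
    · rw [hS1 j (by omega)]
      rw [Fin.sum_univ_eq_sum_range (fun i => if i = 0 then 1 else 0), sum_ite_eq',
        if_pos (mem_range.2 (by omega))]
  · intro h
    simp only [mem_filter, mem_univ, true_and]
    dsimp only at h
    split_ifs at h <;> omega
  · intro h
    simp only [mem_filter, mem_univ, true_and]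
    dsimp only at h
    split_ifs at h <;> omega

/-- Main theorem of the paper: under the stated conditions on the minimal
`f, f'` with `φ_{2,f} = t_{2,f}` and `φ_{1,f'} = t_{1,f'}`, there is a single
matrix in `𝒜(R,S)` realizing all the minimum `k`-term ranks for `k = 1,…,t`. -/
theorem exists_matrix_realizing_all_min_tTermRanks {m n : ℕ}
    (R : Fin m → ℕ) (S : Fin n → ℕ) (hm : 2 < m) (hn : 2 < n)
    (hRS : IsPartitionPair R S) (hne : (ARS R S).Nonempty)
    (t : ℕ) (ht : 0 < t) (f f' : ℕ)
    (hf2 : phi R S 2 f = structMat R S 2 f)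
    (hfmin : ∀ g : ℕ, phi R S 2 g = structMat R S 2 g → f ≤ g)
    (hf1 : phi R S 1 f' = structMat R S 1 f')
    (hf'min : ∀ g : ℕ, phi R S 1 g = structMat R S 1 g → f' ≤ g)
    (h1f : 1 ≤ f) (hff' : f < f') (hf'n : f' < n)
    (hS1 : ∀ j : Fin n, f ≤ (j : ℕ) + 1 → S j = 1)
    (hrho : ∀ k : ℕ, 1 ≤ k → k ≤ t →
      minTermRank k R S = k + f' ∨ minTermRank k R S = 2 * k + f) :
    ∃ A ∈ ARS R S, ∀ k : ℕ, 1 ≤ k → k ≤ t →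
      tTermRank k A = minTermRank k R S := by
  obtain ⟨hR, -, hS, -, htot⟩ := hRS
  have hS1' : ∀ j : Fin n, f ≤ (j : ℕ) → S j = 1 := fun j hj => hS1 j (by omega)
  set P : ℕ → ℤ := fun k => ∑ i ∈ range k, (zeroExt R i : ℤ) with hP
  set Q : ℕ → ℤ := fun l => ∑ j ∈ range l, (zeroExt S j : ℤ) with hQ
  have hT : ∀ k l, k ≤ m → l ≤ n → structMat R S k l = (k : ℤ) * l - Q l + (P m - P k) :=
    fun k l hk hl => structMat_eq R S hk hl
  have hQl : ∀ l, f ≤ l → l ≤ n → Q l = Q f + (l - f) := fun l =>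
    sum_range_zeroExt_eq_add_sub hS1'
  have hQmono : Monotone Q := fun a b hab =>
    sum_le_sum_of_subset_of_nonneg (range_mono hab) fun _ _ _ => by positivity
  have hP0 : P 0 = 0 := sum_range_zero _
  have hPQ : P m = Q n := by
    have h : ∑ i, (R i : ℤ) = ∑ j, (S j : ℤ) := by exact_mod_cast htot
    rwa [sum_eq_sum_range_zeroExt, sum_eq_sum_range_zeroExt] at h
  have hQn := hQl n (by omega) le_rfl
  have hQf' := hQl f' hff'.le hf'n.le
  have hphi1 := (phi_eq_structMat_iff htot (by omega) hf'n.le).1 hf1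
  have hphi2 := (phi_eq_structMat_iff htot (by omega) (by omega)).1 hf2
  have hnonneg : ∀ k j, 1 + k ≤ m → j ≤ f' → 0 ≤ structMat R S (1 + k) j := by
    intro k j hk hj
    have h := hphi1 1 k j 0 le_rfl hk hj (by omega)
    simp only [add_zero, Nat.cast_one, sub_self, zero_mul] at h
    linarith
  have hboth : ∀ a j : ℕ, 2 ≤ a → a ≤ m → j ≤ f →
      P a ≤ a * j + (Q f - Q j) + (n - f) := by
    intro a j h2 ha hj
    have h := hnonneg (a - 1) j (by omega) (by omega)
    rw [show 1 + (a - 1) = a by omega, hT a j ha (by omega)] at h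
    linarith
  have hneither : ∀ b j : ℕ, 2 + b ≤ m → j ≤ f →
      P (2 + b) - P 2 ≤ b * j + (Q f - Q j) := by
    intro b j hb hj
    have h := hphi2 0 b j (n - f) (by omega) hb hj (by omega)
    rw [Nat.add_sub_cancel' (by omega), hT _ _ (by omega) (by omega),
      hT _ _ (by omega) (by omega), hT _ _ (by omega) (by omega), hP0] at h
    push_cast at h
    linarith
  have hsecond : ∀ p j : ℕ, 1 ≤ p → 1 + p ≤ m → j ≤ f →
      P (1 + p) - P 1 ≤ p * j + (Q f - Q j) + (f' - f) := by
    intro p j _ hp hj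
    have h := hphi1 0 p j (n - f') (by omega) hp (by omega) (by omega)
    rw [Nat.add_sub_cancel' hf'n.le, hT _ _ (by omega) (by omega),
      hT _ _ (by omega) (by omega), hT _ _ (by omega) (by omega), hP0] at h
    push_cast at h
    linarith
  have htight : ∃ q j : ℕ, 1 ≤ q ∧ 1 + q ≤ m ∧ j ≤ f ∧
      q * j + (Q f - Q j) + (f' - f) ≤ P (1 + q) - P 1 := by
    obtain ⟨g, rfl⟩ : ∃ g, f' = g + 1 := ⟨f' - 1, by omega⟩
    have hg := hQl g (by omega) (by omega)
    have hne1 : phi R S 1 g ≠ structMat R S 1 g := fun h => by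
      have := hf'min g h
      omega
    rw [Ne, phi_eq_structMat_iff htot (by omega) (by omega)] at hne1
    push Not at hne1
    obtain ⟨i1, q, j, j2, h1, hq, hj, hj2, h⟩ := hne1
    obtain rfl | rfl : i1 = 0 ∨ i1 = 1 := by omega
    · have hlast := hQmono hj2
      have hjg := hQmono hj
      rw [hT _ _ (by omega) (by omega), hT _ _ (by omega) (by omega),
        hT _ _ (by omega) (by omega), hP0] at h
      have hq1 : 1 ≤ q := by
        by_contra h0
        obtain rfl : q = 0 := by omega
        push_cast at h
        linarith
      push_cast at h ⊢
      obtain hjf | hjf := le_total j f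
      · exact ⟨q, j, hq1, hq, hjf, by linarith⟩
      · refine ⟨q, f, hq1, hq, le_rfl, ?_⟩
        have hQj := hQl j hjf (by omega)
        zify at hq1 hjf
        nlinarith [mul_nonneg (sub_nonneg.2 hq1) (sub_nonneg.2 hjf)]
    · have h2 := hnonneg q j hq (by omega)
      have h3 := hQl (g + j2) (by omega) hj2
      rw [hT 1 g (by omega) (by omega), hT 1 _ (by omega) hj2] at h
      push_cast at h h3
      linarith
  obtain ⟨q, j₁, hq1, hqm, hj₁, hq⟩ := htight
  obtain ⟨A, hA, hcov1, hcov2⟩ := exists_mem_ARS_covers_covers (by omega) hR hS htot hff'.le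
    hf'n.le hS1' (fun _ => rfl) (fun _ => rfl) hboth hneither
    (fun p j hp1 hpm hj => prefix_sum_le_of_tight hboth hneither hq1 hqm hj₁ hq hp1 hpm hj)
    hsecond
  have hcard : ∀ {N l : ℕ}, l ≤ N → #{i : Fin N | (i : ℕ) < l} = l := fun hl => by
    rw [Fin.card_filter_val_lt, min_eq_right hl]
  refine ⟨A, hA, fun k hk1 hkt => le_antisymm ?_ (Nat.sInf_le ⟨A, hA, rfl⟩)⟩
  have h1 := tTermRank_le_of_covers hcov1 k
  have h2 := tTermRank_le_of_covers hcov2 k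
  rw [hcard (by omega), hcard (by omega)] at h1 h2
  rcases hrho k hk1 hkt with h | h <;> rw [h] <;> linarith
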